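/- Let θ : W → W be a group automorphism mapping S onto itself, let 𝒦 ⊆ W be a quasiparabolic θ-twisted conjugacy class, and suppose x ∈ 𝒦 is the unique W-minimal element of 𝒦 (x is W-minimal, and every W-minimal element of 𝒦 equals x). Set J = {s ∈ S : ℓ(s·x) < ℓ(x)} and let W_J be the subgroup of W generated by J. Then: (a) s·x·θ(s) = x for all s ∈ J; (b) W_J is finite and θ maps J onto J; (c) x ∈ W_J and ℓ(y) ≤ ℓ(x) for every y ∈ W_J, i.e. x is the longest element of W_J. -/

import Mathlib

noncomputable section

variable {B W : Type*} [Group W] {M : CoxeterMatrix B}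

/-- The `θ`-twisted conjugation action of `W` on itself: `w • x = w·x·θ(w)⁻¹`. -/
def twConj (θ : W ≃* W) (w x : W) : W := w * x * (θ w)⁻¹

/-- The height function `ht = ℓ/2` on `W`. -/
def htL (cs : CoxeterSystem M W) (x : W) : ℚ := (cs.length x : ℚ) / 2

/-- `𝒦` is a `θ`-twisted conjugacy class, i.e. an orbit of the twisted conjugation action. -/
def IsTwClass (θ : W ≃* W) (𝒦 : Set W) : Prop :=
  ∃ x₀ : W, 𝒦 = Set.range fun w => twConj θ w x₀

/-- The `θ`-twisted conjugacy class `𝒦` is quasiparabolic with respect to the height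
function `ht = ℓ/2`: (QP1) and (QP2) hold. -/
def IsQPClass (cs : CoxeterSystem M W) (θ : W ≃* W) (𝒦 : Set W) : Prop :=
  (∀ r : W, cs.IsReflection r → ∀ x ∈ 𝒦,
      htL cs (twConj θ r x) = htL cs x → twConj θ r x = x) ∧
  (∀ r : W, cs.IsReflection r → ∀ x ∈ 𝒦, ∀ i : B,
      htL cs x < htL cs (twConj θ r x) →
      htL cs (twConj θ (cs.simple i) (twConj θ r x)) < htL cs (twConj θ (cs.simple i) x) →
      twConj θ r x = twConj θ (cs.simple i) x)

/-- `x` is a `W`-minimal element: `ℓ(s·x·θ(s)⁻¹) ≥ ℓ(x)` for all simple reflections `s`. -/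
def TwMin (cs : CoxeterSystem M W) (θ : W ≃* W) (x : W) : Prop :=
  ∀ i : B, cs.length x ≤ cs.length (twConj θ (cs.simple i) x)

/-- The automorphism `θ` maps the set `S` of simple reflections onto itself. -/
def SimpleOnto (cs : CoxeterSystem M W) (θ : W ≃* W) : Prop :=
  ⇑θ '' Set.range cs.simple = Set.range cs.simple

namespace CoxeterSystem

open Classical in
/-- The involution `(t, e) ↦ (s t s, e + [t = s])` of `W × ℤ/2` attached to a simple
reflection `s`. -/
def signedConj (cs : CoxeterSystem M W) (i : B) : Equiv.Perm (W × ZMod 2) :=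
  Function.Involutive.toPerm
    (fun p => (cs.simple i * p.1 * cs.simple i, p.2 + if p.1 = cs.simple i then 1 else 0)) <| by
    rintro ⟨t, e⟩
    have h : cs.simple i * t * cs.simple i = cs.simple i ↔ t = cs.simple i := by
      rw [mul_eq_right, mul_eq_one_iff_inv_eq, inv_simple, eq_comm]
    refine Prod.ext ?_ ?_
    · simp [mul_assoc]
    · simp only [h]
      rw [add_assoc, CharTwo.add_self_eq_zero, add_zero]

open Classical in
lemma signedConj_apply (cs : CoxeterSystem M W) (i : B) (t : W) (e : ZMod 2) :
    cs.signedConj i (t, e) =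
      (cs.simple i * t * cs.simple i, e + if t = cs.simple i then 1 else 0) := rfl

open Classical in
lemma signedConj_mul_pow_apply (cs : CoxeterSystem M W) (i j : B) (k : ℕ) (t : W) (e : ZMod 2) :
    ((cs.signedConj i * cs.signedConj j) ^ k) (t, e) =
      ((cs.simple i * cs.simple j) ^ k * t * ((cs.simple i * cs.simple j) ^ k)⁻¹,
        e + ∑ b ∈ Finset.range (2 * k),
          if t = ((cs.simple i * cs.simple j) ^ b)⁻¹ * cs.simple j then 1 else 0) := by
  have hconj : ∀ n : ℕ, cs.simple j * (cs.simple i * cs.simple j) ^ n =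
      ((cs.simple i * cs.simple j) ^ n)⁻¹ * cs.simple j := by
    intro n
    induction n with
    | zero => simp
    | succ n ih =>
      rw [pow_succ, ← mul_assoc, ih, mul_inv_rev, mul_inv_rev, inv_simple, inv_simple]
      rw [← inv_pow, mul_inv_rev, inv_simple, inv_simple]
      have := (Commute.refl (cs.simple j * cs.simple i)).pow_left n
      simp only [← mul_assoc]
      rw [mul_assoc (_ ^ n), this.eq]
  induction k with
  | zero => simp
  | succ k ih =>
    rw [pow_succ', Equiv.Perm.mul_apply, Equiv.Perm.mul_apply, ih]
    set p := cs.simple i * cs.simple j with hp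
    have h₁ : p ^ k * t * (p ^ k)⁻¹ = cs.simple j ↔ t = (p ^ (2 * k))⁻¹ * cs.simple j := by
      rw [mul_inv_eq_iff_eq_mul, hconj, ← eq_inv_mul_iff_mul_eq, two_mul, pow_add, mul_inv_rev,
        mul_assoc]
    have h₂ : cs.simple j * (p ^ k * t * (p ^ k)⁻¹) * cs.simple j = cs.simple i ↔
        t = (p ^ (2 * k + 1))⁻¹ * cs.simple j := by
      have h₃ : cs.simple j * (p ^ k * t * (p ^ k)⁻¹) * cs.simple j = cs.simple i ↔
          p * (p ^ k * t * (p ^ k)⁻¹) = cs.simple j := by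
        constructor <;> intro h
        · have := congrArg (fun z => cs.simple i * z * cs.simple j) h
          simpa [hp, mul_assoc] using this
        · have := congrArg (fun z => cs.simple i * z * cs.simple j) h
          simpa [hp, mul_assoc] using this
      rw [h₃, ← mul_assoc, ← mul_assoc, mul_inv_eq_iff_eq_mul, hconj, ← pow_succ',
        ← eq_inv_mul_iff_mul_eq, ← mul_assoc, ← mul_inv_rev, ← pow_add]
      rw [show k + (k + 1) = 2 * k + 1 by ring]
    rw [show 2 * (k + 1) = 2 * k + 1 + 1 by ring, Finset.sum_range_succ, Finset.sum_range_succ]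
    simp only [signedConj_apply, h₁, h₂]
    refine Prod.ext ?_ ?_
    · simp [pow_succ', hp, mul_assoc]
    · simp only [add_assoc]

lemma isLiftable_signedConj (cs : CoxeterSystem M W) : M.IsLiftable cs.signedConj := by
  classical
  intro i j
  refine Equiv.ext ?_
  rintro ⟨t, e⟩
  rw [signedConj_mul_pow_apply, two_mul, Finset.sum_range_add]
  simp [pow_add, CharTwo.add_self_eq_zero]

open Classical in
lemma lift_signedConj_wordProd (cs : CoxeterSystem M W) (ω : List B) (t : W) (e : ZMod 2) :
    cs.lift ⟨_, cs.isLiftable_signedConj⟩ (cs.wordProd ω) (t, e) =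
      (cs.wordProd ω * t * (cs.wordProd ω)⁻¹, e + ((cs.rightInvSeq ω).count t : ZMod 2)) := by
  induction ω with
  | nil => simp
  | cons i ω ih =>
    rw [wordProd_cons, map_mul, Equiv.Perm.mul_apply, ih, lift_apply_simple]
    have h : cs.wordProd ω * t * (cs.wordProd ω)⁻¹ = cs.simple i ↔
        (cs.wordProd ω)⁻¹ * cs.simple i * cs.wordProd ω = t := by
      rw [mul_inv_eq_iff_eq_mul, ← eq_inv_mul_iff_mul_eq, mul_assoc, eq_comm]
    simp only [signedConj_apply, rightInvSeq, h, List.count_cons]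
    refine Prod.ext ?_ ?_
    · simp [mul_assoc]
    · push_cast
      simp [add_assoc]

/-- The exchange property: a right descent of `π ω` occurs in the right inversion sequence
of `ω`. -/
lemma simple_mem_rightInvSeq (cs : CoxeterSystem M W) {ω : List B} {i : B}
    (h : cs.IsRightDescent (cs.wordProd ω) i) : cs.simple i ∈ cs.rightInvSeq ω := by
  classical
  obtain ⟨γ, hγ, hγω⟩ := cs.exists_isReduced (cs.wordProd ω * cs.simple i)
  have hprod : cs.wordProd (γ.concat i) = cs.wordProd ω := by
    rw [wordProd_concat, ← hγω, simple_mul_simple_cancel_right]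
  have hnot : cs.simple i ∉ cs.rightInvSeq γ := by
    intro hmem
    have := (cs.isRightInversion_of_mem_rightInvSeq hγ hmem).2
    rw [← hγω, simple_mul_simple_cancel_right] at this
    exact lt_asymm this h
  have hcount : (cs.rightInvSeq (γ.concat i)).count (cs.simple i) = 1 := by
    rw [rightInvSeq_concat, List.concat_eq_append, List.count_append]
    have h0 : (List.map (MulAut.conj (cs.simple i)) (cs.rightInvSeq γ)).count (cs.simple i) = 0 := by
      rw [List.count_eq_zero, List.mem_map]
      rintro ⟨t, ht, hti⟩
      rw [MulAut.conj_apply, inv_simple, mul_eq_right, mul_eq_one_iff_inv_eq, inv_simple] at hti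
      exact hnot (hti ▸ ht)
    rw [h0]
    simp
  have h₁ := cs.lift_signedConj_wordProd (γ.concat i) (cs.simple i) 0
  rw [hprod, cs.lift_signedConj_wordProd, hcount] at h₁
  have h₂ := (Prod.ext_iff.1 h₁).2
  by_contra hmem
  rw [List.count_eq_zero.2 hmem] at h₂
  simp at h₂

lemma simple_mem_leftInvSeq (cs : CoxeterSystem M W) {ω : List B} {i : B}
    (h : cs.IsLeftDescent (cs.wordProd ω) i) : cs.simple i ∈ cs.leftInvSeq ω := by
  rw [← isRightDescent_inv_iff, ← wordProd_reverse] at h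
  simpa [rightInvSeq_reverse] using cs.simple_mem_rightInvSeq h

lemma exists_simple_mul_wordProd_eq (cs : CoxeterSystem M W) {ω : List B} {i : B}
    (h : cs.IsLeftDescent (cs.wordProd ω) i) :
    ∃ j < ω.length, cs.simple i * cs.wordProd ω = cs.wordProd (ω.eraseIdx j) := by
  obtain ⟨j, hj, hji⟩ := List.mem_iff_getElem.1 (cs.simple_mem_leftInvSeq h)
  refine ⟨j, by simpa using hj, ?_⟩
  rw [← getD_leftInvSeq_mul_wordProd, List.getD_eq_getElem _ _ hj, hji]

lemma finite_setOf_isLeftDescent (cs : CoxeterSystem M W) (x : W) :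
    (cs.simple '' {i | cs.IsLeftDescent x i}).Finite := by
  obtain ⟨ω, -, rfl⟩ := cs.exists_isReduced x
  refine (List.finite_toSet (cs.leftInvSeq ω)).subset ?_
  rintro _ ⟨i, hi, rfl⟩
  exact cs.simple_mem_leftInvSeq hi

/-- Elements of a standard parabolic subgroup have reduced words in its generators. -/
lemma exists_isReduced_of_mem_closure (cs : CoxeterSystem M W) {I : Set B} {y : W}
    (hy : y ∈ Subgroup.closure (cs.simple '' I)) :
    ∃ ω : List B, (∀ i ∈ ω, i ∈ I) ∧ cs.IsReduced ω ∧ y = cs.wordProd ω := by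
  have step : ∀ i ∈ I, ∀ y : W,
      (∃ ω : List B, (∀ i ∈ ω, i ∈ I) ∧ cs.IsReduced ω ∧ y = cs.wordProd ω) →
      ∃ ω : List B, (∀ i ∈ ω, i ∈ I) ∧ cs.IsReduced ω ∧ cs.simple i * y = cs.wordProd ω := by
    rintro i hi _ ⟨ω, hω, hred, rfl⟩
    by_cases h : cs.IsLeftDescent (cs.wordProd ω) i
    · obtain ⟨j, hj, hji⟩ := cs.exists_simple_mul_wordProd_eq h
      refine ⟨ω.eraseIdx j, fun k hk => hω k (List.mem_of_mem_eraseIdx hk), ?_, hji⟩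
      rw [isLeftDescent_iff, hji, hred.eq] at h
      rw [IsReduced, List.length_eraseIdx_of_lt hj]
      omega
    · refine ⟨i :: ω, ?_, ?_, (cs.wordProd_cons i ω).symm⟩
      · simpa using ⟨hi, hω⟩
      · rw [not_isLeftDescent_iff, hred.eq] at h
        rw [IsReduced, wordProd_cons, h, List.length_cons]
  induction hy using Subgroup.closure_induction_left with
  | one => exact ⟨[], by simp, by simp [IsReduced], by simp⟩
  | mul_left s hs y _ ih =>
    obtain ⟨i, hi, rfl⟩ := hs
    exact step i hi y ih
  | inv_mul_cancel s hs y _ ih =>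
    obtain ⟨i, hi, rfl⟩ := hs
    rw [inv_simple]
    exact step i hi y ih

/-- If all elements of `I` are left descents of `x`, then every reduced word in `I` is an initial segment
of a reduced word of `x`. -/
lemma length_inv_wordProd_mul_add (cs : CoxeterSystem M W) {x : W} {ω : List B}
    (hω : ∀ i ∈ ω, cs.IsLeftDescent x i) (hred : cs.IsReduced ω) :
    cs.length ((cs.wordProd ω)⁻¹ * x) + ω.length = cs.length x := by
  induction ω with
  | nil => simp
  | cons i ω ih =>
    have hred' : cs.IsReduced ω := by simpa using hred.drop 1
    have ih := ih (fun k hk => hω k (List.mem_cons_of_mem _ hk)) hred'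
    obtain ⟨γ, hγ, hγx⟩ := cs.exists_isReduced ((cs.wordProd ω)⁻¹ * x)
    have hx : x = cs.wordProd (ω ++ γ) := by
      rw [wordProd_append, ← hγx, mul_inv_cancel_left]
    have hi := hω i List.mem_cons_self
    rw [hx] at hi
    obtain ⟨j, hj, hji⟩ := cs.exists_simple_mul_wordProd_eq hi
    have hlower := cs.length_mul_le (cs.wordProd (i :: ω)) ((cs.wordProd (i :: ω))⁻¹ * x)
    rw [mul_inv_cancel_left, hred.eq] at hlower
    rw [hγx, hγ.eq] at ih
    rw [List.length_append] at hj
    rcases lt_or_ge j ω.length with hjω | hjω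
    · rw [List.eraseIdx_append_of_lt_length hjω, wordProd_append, wordProd_append, ← mul_assoc,
        mul_left_inj, ← wordProd_cons] at hji
      have := cs.length_wordProd_le (ω.eraseIdx j)
      rw [← hji, hred.eq, List.length_eraseIdx_of_lt hjω, List.length_cons] at this
      omega
    · rw [List.eraseIdx_append_of_length_le hjω, wordProd_append, ← wordProd_append, ← hx,
        wordProd_append] at hji
      have heq : (cs.wordProd (i :: ω))⁻¹ * x = cs.wordProd (γ.eraseIdx (j - ω.length)) := by
        rw [wordProd_cons, mul_inv_rev, inv_simple, mul_assoc, hji, inv_mul_cancel_left]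
      have := cs.length_wordProd_le (γ.eraseIdx (j - ω.length))
      rw [← heq, List.length_eraseIdx_of_lt (by omega)] at this
      rw [List.length_cons] at hlower ⊢
      omega

lemma length_inv_mul_add_length (cs : CoxeterSystem M W) {x y : W}
    (hy : y ∈ Subgroup.closure (cs.simple '' {i | cs.IsLeftDescent x i})) :
    cs.length (y⁻¹ * x) + cs.length y = cs.length x := by
  obtain ⟨ω, hω, hred, rfl⟩ := cs.exists_isReduced_of_mem_closure hy
  rw [hred.eq]
  exact cs.length_inv_wordProd_mul_add hω hred

/-- The left descents of an element generate a finite parabolic subgroup. -/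
lemma finite_closure_isLeftDescent (cs : CoxeterSystem M W) (x : W) :
    (Subgroup.closure (cs.simple '' {i | cs.IsLeftDescent x i}) : Set W).Finite := by
  have := (cs.finite_setOf_isLeftDescent x).to_subtype
  refine ((List.finite_length_le (cs.simple '' {i | cs.IsLeftDescent x i})
    (cs.length x)).image fun l => (l.map Subtype.val).prod).subset ?_
  intro y hy
  obtain ⟨ω, hω, hred, rfl⟩ := cs.exists_isReduced_of_mem_closure hy
  have hlen := cs.length_inv_wordProd_mul_add hω hred
  have hmem : ∀ t ∈ ω.map cs.simple, t ∈ cs.simple '' {i | cs.IsLeftDescent x i} := by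
    intro t ht
    obtain ⟨i, hi, rfl⟩ := List.mem_map.1 ht
    exact ⟨i, hω i hi, rfl⟩
  refine ⟨(ω.map cs.simple).attach.map fun t => ⟨t.1, hmem t.1 t.2⟩, ?_, ?_⟩
  · rw [Set.mem_ofPred_eq, List.length_map, List.length_attach, List.length_map]
    omega
  · simp only [List.map_map, Function.comp_def]
    rw [List.attach_map_subtype_val]
    rfl

lemma mem_of_simple_mem_closure (cs : CoxeterSystem M W) {I : Set B} {i : B}
    (hi : cs.simple i ∈ Subgroup.closure (cs.simple '' I)) : cs.simple i ∈ cs.simple '' I := by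
  obtain ⟨ω, hω, hred, h⟩ := cs.exists_isReduced_of_mem_closure hi
  have hlen := hred.eq
  rw [← h, length_simple] at hlen
  obtain ⟨k, rfl⟩ := List.length_eq_one_iff.1 hlen.symm
  rw [h, wordProd_singleton]
  exact ⟨k, hω k (by simp), rfl⟩

end CoxeterSystem

/-- Let `𝒦` be a quasiparabolic `θ`-twisted conjugacy class with unique
`W`-minimal element `x`, and let `J = {s ∈ S : ℓ(s·x) < ℓ(x)}`, `W_J = ⟨J⟩`. Then:
(a) `s·x·θ(s) = x` for all `s ∈ J`; (b) `W_J` is finite and `θ(J) = J`;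
(c) `x ∈ W_J` and `x` is the longest element of `W_J`. -/
theorem stmt11 (cs : CoxeterSystem M W) (θ : W ≃* W) (hθS : SimpleOnto cs θ)
    (𝒦 : Set W) (hK : IsTwClass θ 𝒦) (hqp : IsQPClass cs θ 𝒦)
    (x : W) (hx : x ∈ 𝒦) (hmin : TwMin cs θ x)
    (huniq : ∀ y ∈ 𝒦, TwMin cs θ y → y = x)
    (SJ : Set W)
    (hSJ : SJ = {s | s ∈ Set.range cs.simple ∧ cs.length (s * x) < cs.length x}) :
    (∀ s ∈ SJ, s * x * θ s = x) ∧
    ((Subgroup.closure SJ : Set W).Finite ∧ ⇑θ '' SJ = SJ) ∧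
    (x ∈ Subgroup.closure SJ ∧ ∀ y ∈ Subgroup.closure SJ, cs.length y ≤ cs.length x) := by
  set D : Set B := {i | cs.IsLeftDescent x i}
  have hSJ' : SJ = cs.simple '' D := by
    rw [hSJ]
    ext s
    constructor
    · rintro ⟨⟨i, rfl⟩, hi⟩
      exact ⟨i, hi, rfl⟩
    · rintro ⟨i, hi, rfl⟩
      exact ⟨⟨i, rfl⟩, hi⟩
  clear hSJ
  subst hSJ'
  have hθ : ∀ i, ∃ k, θ (cs.simple i) = cs.simple k := fun i => by
    have h : θ (cs.simple i) ∈ Set.range cs.simple := (Set.ext_iff.1 hθS _).1 ⟨_, ⟨i, rfl⟩, rfl⟩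
    obtain ⟨k, hk⟩ := h
    exact ⟨k, hk.symm⟩
  have hθ' : ∀ k, ∃ i, θ (cs.simple i) = cs.simple k := fun k => by
    have h : cs.simple k ∈ ⇑θ '' Set.range cs.simple := (Set.ext_iff.1 hθS _).2 ⟨k, rfl⟩
    obtain ⟨_, ⟨i, rfl⟩, hk⟩ := h
    exact ⟨i, hk⟩
  have htw : ∀ i, twConj θ (cs.simple i) x = cs.simple i * x * θ (cs.simple i) := fun i => by
    rw [twConj, ← map_inv, cs.inv_simple]
  have hfix : ∀ i, cs.length (cs.simple i * x * θ (cs.simple i)) ≤ cs.length x →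
      cs.simple i * x * θ (cs.simple i) = x := fun i hi => by
    rw [← htw] at hi ⊢
    refine hqp.1 _ (cs.isReflection_simple i) x hx ?_
    rw [htL, htL, le_antisymm hi (hmin i)]
  have hleft : ∀ i ∈ D, cs.simple i * x * θ (cs.simple i) = x := fun i hi => by
    refine hfix i ?_
    obtain ⟨k, hk⟩ := hθ i
    have h₁ := cs.length_mul_le (cs.simple i * x) (cs.simple k)
    have h₂ := cs.isLeftDescent_iff.1 hi
    rw [cs.length_simple] at h₁
    rw [hk]
    omega
  have hcomm : ∀ i, cs.simple i * x * θ (cs.simple i) = x →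
      x * θ (cs.simple i) = cs.simple i * x := fun i hi => by
    nth_rw 2 [← hi]
    rw [← mul_assoc, cs.simple_mul_simple_cancel_left]
  have hright : ∀ i k, θ (cs.simple i) = cs.simple k → cs.IsRightDescent x k →
      i ∈ D ∧ x * cs.simple k = cs.simple i * x := fun i k hik hk => by
    have h : x * cs.simple k = cs.simple i * x := by
      rw [← hik]
      refine hcomm i (hfix i ?_)
      have h₁ := cs.length_mul_le (cs.simple i) (x * cs.simple k)
      have h₂ := cs.isRightDescent_iff.1 hk
      rw [cs.length_simple] at h₁
      rw [hik, mul_assoc]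
      omega
    exact ⟨show cs.length (cs.simple i * x) < cs.length x from h ▸ hk, h⟩
  have hfin := cs.finite_closure_isLeftDescent x
  have hlen : ∀ y ∈ Subgroup.closure (cs.simple '' D),
      cs.length (y⁻¹ * x) + cs.length y = cs.length x := fun y hy =>
    cs.length_inv_mul_add_length hy
  have hxmem : x ∈ Subgroup.closure (cs.simple '' D) := by
    obtain ⟨w, hw, hmax⟩ := Set.exists_max_image _ cs.length hfin ⟨1, Subgroup.one_mem _⟩
    by_contra hx'
    have hv : w⁻¹ * x ≠ 1 := fun h => hx' (inv_mul_eq_one.1 h ▸ hw)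
    obtain ⟨k, hk⟩ := cs.exists_rightDescent_of_ne_one hv
    rw [CoxeterSystem.IsRightDescent] at hk
    have hw' := hlen w hw
    have hxk : cs.IsRightDescent x k := by
      have h := cs.length_mul_le w (w⁻¹ * x * cs.simple k)
      rw [mul_assoc w⁻¹, mul_inv_cancel_left, ← mul_assoc w⁻¹] at h
      rw [CoxeterSystem.IsRightDescent]
      omega
    obtain ⟨i, hi⟩ := hθ' k
    obtain ⟨hiD, hik⟩ := hright i k hi hxk
    have hsw : cs.simple i * w ∈ Subgroup.closure (cs.simple '' D) :=
      Subgroup.mul_mem _ (Subgroup.subset_closure ⟨i, hiD, rfl⟩) hw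
    have h₁ := hlen _ hsw
    have h₂ := hmax _ hsw
    rw [mul_inv_rev, cs.inv_simple, mul_assoc, ← hik, ← mul_assoc] at h₁
    omega
  refine ⟨?_, ⟨hfin, ?_⟩, hxmem, fun y hy => ?_⟩
  · rintro _ ⟨i, hi, rfl⟩
    exact hleft i hi
  · refine Set.Subset.antisymm ?_ ?_
    · rintro _ ⟨_, ⟨i, hi, rfl⟩, rfl⟩
      obtain ⟨k, hk⟩ := hθ i
      have h : θ (cs.simple i) = x⁻¹ * (cs.simple i * x) := by
        rw [← hcomm i (hleft i hi), inv_mul_cancel_left]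
      have hmem : θ (cs.simple i) ∈ Subgroup.closure (cs.simple '' D) := by
        rw [h]
        exact Subgroup.mul_mem _ (Subgroup.inv_mem _ hxmem)
          (Subgroup.mul_mem _ (Subgroup.subset_closure ⟨i, hi, rfl⟩) hxmem)
      rw [hk] at hmem ⊢
      exact cs.mem_of_simple_mem_closure hmem
    · rintro _ ⟨k, hk, rfl⟩
      obtain ⟨i, hi⟩ := hθ' k
      have hxk : cs.IsRightDescent x k := by
        have h₁ := hlen _ (Subgroup.mul_mem _ hxmem (Subgroup.subset_closure ⟨k, hk, rfl⟩))
        have h₂ := cs.length_mul_simple_ne x k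
        rw [CoxeterSystem.IsRightDescent]
        omega
      exact ⟨cs.simple i, ⟨i, (hright i k hi hxk).1, rfl⟩, hi⟩
  · exact (Nat.le_add_left _ _).trans (hlen y hy).le

end
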